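/- The generating function identity Σ_λ q^{|λ|} ∏_{□∈λ} h_□^{-2} = e^q holds, where the sum is over all partitions λ (including the empty partition) and h_□ denotes the hook length. -/

import Mathlib

open Finset

/-- Hook length of a box `c` (0-indexed) in a Young diagram. -/
def hook (μ : YoungDiagram) (c : ℕ × ℕ) : ℕ :=
  μ.rowLen c.1 + μ.colLen c.2 - c.1 - c.2 - 1

/-- Replacing each row in turn by the corresponding row of `N` gives the same sum of determinants
as replacing each column in turn by the corresponding column of `N`. -/
theorem Matrix.sum_det_updateRow_eq_sum_det_updateCol {n R : Type*} [Fintype n] [DecidableEq n]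
    [CommRing R] (M : Matrix n n R) (N : n → n → R) :
    ∑ i, (M.updateRow i (N i)).det = ∑ j, (M.updateCol j (fun i => N i j)).det := by
  have hrow (i : n) : (M.updateRow i (N i)).det = ∑ j, M.adjugate j i * N i j := by
    rw [← Matrix.cramer_transpose_apply, Matrix.cramer_eq_adjugate_mulVec,
      ← Matrix.adjugate_transpose]
    rfl
  have hcol (j : n) : (M.updateCol j (fun i => N i j)).det = ∑ i, M.adjugate j i * N i j := by
    rw [← Matrix.cramer_apply, Matrix.cramer_eq_adjugate_mulVec]
    rfl
  simp_rw [hrow, hcol]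
  exact Finset.sum_comm

/-- The reciprocal of the factorial, extended by zero to negative integers. -/
noncomputable def invFactorial (m : ℤ) : ℝ :=
  if 0 ≤ m then (m.toNat.factorial : ℝ)⁻¹ else 0

theorem invFactorial_of_neg {m : ℤ} (hm : m < 0) : invFactorial m = 0 := by
  simp [invFactorial, hm]

theorem invFactorial_natCast (m : ℕ) : invFactorial m = (m.factorial : ℝ)⁻¹ := by
  simp [invFactorial]

theorem intCast_mul_invFactorial (m : ℤ) : (m : ℝ) * invFactorial m = invFactorial (m - 1) := by
  rcases lt_trichotomy m 0 with hm | rfl | hm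
  · rw [invFactorial_of_neg hm, invFactorial_of_neg (by omega), mul_zero]
  · simp [invFactorial]
  · obtain ⟨n, rfl⟩ : ∃ n : ℕ, m = (n + 1 : ℕ) := ⟨(m - 1).toNat, by omega⟩
    rw [show ((n + 1 : ℕ) : ℤ) - 1 = n by push_cast; ring, invFactorial_natCast,
      invFactorial_natCast, Nat.factorial_succ]
    push_cast
    field_simp

/-- Aitken's matrix, with entries `1 / (lᵢ - j)!`. -/
noncomputable def aitkenMatrix {k : ℕ} (l : Fin k → ℤ) : Matrix (Fin k) (Fin k) ℝ :=
  Matrix.of fun i j => invFactorial (l i - j)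

/-- Aitken's determinant. -/
noncomputable def aitkenDet {k : ℕ} (l : Fin k → ℤ) : ℝ := (aitkenMatrix l).det

theorem aitkenMatrix_add_single {k : ℕ} (l : Fin k → ℤ) (i : Fin k) (a : ℤ) :
    aitkenMatrix (l + Pi.single i a) =
      (aitkenMatrix l).updateRow i (fun j => invFactorial (l i + a - j)) := by
  ext r j
  rcases eq_or_ne r i with rfl | h
  · simp [aitkenMatrix]
  · simp [aitkenMatrix, h]

theorem aitkenDet_eq_zero_of_neg {k : ℕ} {l : Fin k → ℤ} {i : Fin k} (hi : l i < 0) :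
    aitkenDet l = 0 :=
  Matrix.det_eq_zero_of_row_eq_zero i fun j => invFactorial_of_neg (by omega)

theorem aitkenDet_eq_zero_of_not_injective {k : ℕ} {l : Fin k → ℤ}
    (hl : ¬ Function.Injective l) : aitkenDet l = 0 := by
  simp only [Function.Injective, not_forall] at hl
  obtain ⟨a, b, hab, hne⟩ := hl
  exact Matrix.det_zero_of_row_eq hne (by ext j; simp [aitkenMatrix, hab])

theorem sum_aitkenDet_sub_single {k : ℕ} (l : Fin k → ℤ) :
    ∑ i, aitkenDet (l + Pi.single i (-1)) =
      (∑ i, (l i : ℝ) - ∑ i : Fin k, (i : ℝ)) * aitkenDet l := by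
  set M := aitkenMatrix l with hM
  have hrow (i : Fin k) : aitkenDet (l + Pi.single i (-1)) =
      l i * M.det - (M.updateRow i (fun j => (j : ℝ) * M i j)).det := by
    have : (fun j : Fin k => invFactorial (l i + -1 - j)) =
        (l i : ℝ) • M i + (-1 : ℝ) • (fun j : Fin k => (j : ℝ) * M i j) := by
      ext j
      have h := intCast_mul_invFactorial (l i - j)
      rw [show l i + -1 - (j : ℤ) = l i - j - 1 by ring, ← h]
      simp only [hM, aitkenMatrix, Pi.add_apply, Pi.smul_apply, Matrix.of_apply, smul_eq_mul]
      push_cast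
      ring
    rw [aitkenDet, aitkenMatrix_add_single, this, Matrix.det_updateRow_add,
      Matrix.det_updateRow_smul, Matrix.det_updateRow_smul, Matrix.updateRow_eq_self]
    ring
  have hcol (j : Fin k) : (M.updateCol j (fun i => (j : ℝ) * M i j)).det = j * M.det := by
    have := Matrix.det_updateCol_smul M j (j : ℝ) (fun i => M i j)
    rwa [Matrix.updateCol_eq_self] at this
  simp_rw [hrow]
  have hswap := Matrix.sum_det_updateRow_eq_sum_det_updateCol M (fun i j => (j : ℝ) * M i j)
  simp_rw [hcol] at hswap
  rw [Finset.sum_sub_distrib, hswap, ← Finset.sum_mul, ← Finset.sum_mul, ← sub_mul]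
  rfl

theorem sum_aitkenDet_add_single {k : ℕ} (l : Fin k → ℤ) {r : Fin k} (hr : l r = 0) :
    ∑ i, aitkenDet (l + Pi.single i 1) = aitkenDet l := by
  obtain _ | m := k
  · exact r.elim0
  set M := aitkenMatrix l with hM
  have hcol (j : Fin m) :
      (M.updateCol j.succ (fun i => invFactorial (l i + 1 - (j.succ : Fin (m + 1))))).det = 0 := by
    refine Matrix.det_zero_of_column_eq (i := j.castSucc) (j := j.succ)
      (Fin.castSucc_lt_succ).ne fun i => ?_
    rw [Matrix.updateCol_self, Matrix.updateCol_ne (Fin.castSucc_lt_succ).ne]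
    simp [hM, aitkenMatrix]
  have hfirst : (M.updateCol 0 (fun i => invFactorial (l i + 1 - (0 : Fin (m + 1))))).det =
      M.det := by
    have hsplit : (fun i => invFactorial (l i + 1 - (0 : Fin (m + 1)))) =
        (fun i => M i 0) + fun i => invFactorial (l i + 1) - invFactorial (l i) := by
      ext i
      simp [hM, aitkenMatrix]
    have hzero :
        (M.updateCol 0 fun i => invFactorial (l i + 1) - invFactorial (l i)).det = 0 := by
      refine Matrix.det_eq_zero_of_row_eq_zero r fun j => ?_
      refine Fin.cases ?_ (fun j => ?_) j
      · simp [hr, invFactorial]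
      · rw [Matrix.updateCol_ne (Fin.succ_ne_zero j)]
        exact invFactorial_of_neg (by simp [hr]; omega)
    rw [hsplit, Matrix.det_updateCol_add, Matrix.updateCol_eq_self, hzero, add_zero]
  have hrow (i : Fin (m + 1)) : aitkenDet (l + Pi.single i 1) =
      (M.updateRow i (fun j => invFactorial (l i + 1 - j))).det := by
    rw [aitkenDet, aitkenMatrix_add_single]
  simp_rw [hrow]
  refine (Matrix.sum_det_updateRow_eq_sum_det_updateCol M
    (fun i j => invFactorial (l i + 1 - j))).trans ?_
  rw [Fin.sum_univ_succ, hfirst]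
  simp only [hcol, Finset.sum_const_zero, add_zero]
  rfl

theorem aitkenDet_natCast {k : ℕ} (l : Fin k → ℕ) :
    aitkenDet (fun i => (l i : ℤ)) =
      (∏ i, ((l i).factorial : ℝ)⁻¹) * ∏ i, ∏ j ∈ Ioi i, ((l j : ℝ) - l i) := by
  have h := Matrix.det_eval_matrixOfPolynomials_eq_det_vandermonde (fun i => (l i : ℝ))
    (fun j => descPochhammer ℝ j) (fun j => descPochhammer_natDegree ℝ j)
    (fun j => monic_descPochhammer ℝ j)
  rw [← Matrix.det_vandermonde, h, ← Matrix.det_mul_column, aitkenDet]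
  congr 1
  ext i j
  simp only [aitkenMatrix, Matrix.of_apply, descPochhammer_eval_eq_descFactorial]
  by_cases hij : (j : ℕ) ≤ l i
  · rw [← Nat.cast_sub hij, invFactorial_natCast, ← Nat.factorial_mul_descFactorial hij]
    have : ((l i).descFactorial j : ℝ) ≠ 0 := by
      exact_mod_cast (Nat.descFactorial_pos.2 hij).ne'
    push_cast
    field_simp
  · rw [invFactorial_of_neg (by omega), Nat.descFactorial_of_lt (by omega)]
    simp

/-- The first-column hook sequences with `k` entries of the partitions of `n` into at most `k`
parts. -/
def betaSequences (k n : ℕ) : Finset (Fin k → ℕ) :=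
  open Classical in {l ∈ piAntidiag univ (n + ∑ i : Fin k, (i : ℕ)) | StrictAnti l}

theorem mem_betaSequences {k n : ℕ} {l : Fin k → ℕ} :
    l ∈ betaSequences k n ↔ ∑ i, l i = n + ∑ i : Fin k, (i : ℕ) ∧ StrictAnti l := by
  simp [betaSequences, mem_piAntidiag]

theorem StrictAnti.apply_add_val_le {k : ℕ} {l : Fin k → ℕ} (hl : StrictAnti l) {i j : Fin k}
    (hij : i ≤ j) : l j + j ≤ l i + i := by
  have h : #(Ioc i j) ≤ #(Ico (l j) (l i)) := by
    refine card_le_card_of_injOn l (fun a ha => ?_) hl.injective.injOn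
    rw [coe_Ioc, Set.mem_Ioc] at ha
    rw [coe_Ico, Set.mem_Ico]
    exact ⟨hl.antitone ha.2, hl ha.1⟩
  rw [Fin.card_Ioc, Nat.card_Ico] at h
  have := hl.antitone hij
  have : (i : ℕ) ≤ j := hij
  omega

theorem StrictAnti.rev_add_le {k : ℕ} {l : Fin k → ℕ} (hl : StrictAnti l) {c : ℕ}
    (hc : ∀ i, c ≤ l i) (i : Fin k) : (i.rev : ℕ) + c ≤ l i := by
  have hi := i.isLt
  have h := hl.apply_add_val_le (i := i) (j := ⟨k - 1, by omega⟩) (Fin.mk_le_mk.2 (by omega))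
  have := hc ⟨k - 1, by omega⟩
  rw [Fin.val_rev]
  simp only at h
  omega

theorem sum_val_rev (k : ℕ) : ∑ i : Fin k, (i.rev : ℕ) = ∑ i : Fin k, (i : ℕ) :=
  Equiv.sum_comp Fin.revPerm fun i : Fin k => (i : ℕ)

theorem exists_eq_zero_of_mem_betaSequences {k n : ℕ} (hn : n < k) {l : Fin k → ℕ}
    (hl : l ∈ betaSequences k n) : ∃ r, l r = 0 := by
  by_contra! h
  obtain ⟨hsum, hanti⟩ := mem_betaSequences.1 hl
  have := sum_le_sum fun i (_ : i ∈ univ) =>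
    hanti.rev_add_le (fun i => Nat.one_le_iff_ne_zero.2 (h i)) i
  rw [sum_add_distrib, sum_val_rev, hsum] at this
  simp at this
  omega

theorem sum_sum_aitkenDet_mul_comm (k n : ℕ) :
    ∑ l ∈ betaSequences k (n + 1), ∑ i,
        aitkenDet (fun j => (l j : ℤ)) *
          aitkenDet ((fun j => (l j : ℤ)) + Pi.single i (-1)) =
      ∑ l ∈ betaSequences k n, ∑ i,
        aitkenDet (fun j => (l j : ℤ)) *
          aitkenDet ((fun j => (l j : ℤ)) + Pi.single i 1) := by
  rw [← sum_product', ← sum_product']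
  have hcast_sub (l : Fin k → ℕ) (i : Fin k) (hi : 0 < l i) :
      (fun j => ((l - Pi.single i 1 : Fin k → ℕ) j : ℤ)) =
        (fun j => (l j : ℤ)) + Pi.single i (-1) := by
    ext j
    rcases eq_or_ne j i with rfl | h
    · simp only [Pi.sub_apply, Pi.add_apply, Pi.single_eq_same]
      omega
    · simp [h]
  have hcast_add (l : Fin k → ℕ) (i : Fin k) :
      (fun j => ((l + Pi.single i 1 : Fin k → ℕ) j : ℤ)) =
        (fun j => (l j : ℤ)) + Pi.single i 1 := by
    ext j
    rcases eq_or_ne j i with rfl | h <;> simp [*]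
  have hpos (l : Fin k → ℕ) (i : Fin k)
      (h : aitkenDet ((fun j => (l j : ℤ)) + Pi.single i (-1)) ≠ 0) : 0 < l i := by
    by_contra h0
    refine h (aitkenDet_eq_zero_of_neg (i := i) ?_)
    simp only [Pi.add_apply, Pi.single_eq_same]
    omega
  have hinj (l : Fin k → ℕ) (h : aitkenDet (fun j => (l j : ℤ)) ≠ 0) :
      Function.Injective l := by
    by_contra hl
    exact h (aitkenDet_eq_zero_of_not_injective fun h' =>
      hl fun a b hab => h' (by simp [hab]))
  have hsingle (i : Fin k) : ∑ j, (Pi.single i 1 : Fin k → ℕ) j = 1 := by simp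
  have hle_one (i j : Fin k) : (Pi.single i 1 : Fin k → ℕ) j ≤ 1 := by
    rcases eq_or_ne j i with rfl | h <;> simp [*]
  refine sum_bij_ne_zero (fun p _ _ => (p.1 - Pi.single p.2 1, p.2)) ?_ ?_ ?_ ?_
  · rintro ⟨l, i⟩ hp hne
    have h0 := hpos l i (right_ne_zero_of_mul hne)
    obtain ⟨hsum, hanti⟩ := mem_betaSequences.1 (mem_product.1 hp).1
    have hle (j : Fin k) : (Pi.single i 1 : Fin k → ℕ) j ≤ l j := by
      rcases eq_or_ne j i with rfl | h
      · simpa using Nat.succ_le_of_lt h0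
      · simp [h]
    refine mem_product.2 ⟨mem_betaSequences.2 ⟨?_, ?_⟩, mem_univ _⟩
    · have : ∑ j, (l - Pi.single i 1 : Fin k → ℕ) j + ∑ j, (Pi.single i 1 : Fin k → ℕ) j =
          ∑ j, l j := by
        rw [← sum_add_distrib]
        exact sum_congr rfl fun j _ => Nat.sub_add_cancel (hle j)
      rw [hsingle] at this
      simp only at hsum ⊢
      omega
    · refine Antitone.strictAnti_of_injective (fun a b hab => ?_) (hinj _ ?_)
      · rcases hab.eq_or_lt with rfl | hab
        · rfl
        · have : l b < l a := hanti hab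
          have := hle_one i a
          simp only [Pi.sub_apply] at this ⊢
          omega
      · rw [hcast_sub l i h0]
        exact right_ne_zero_of_mul hne
  · rintro ⟨l, i⟩ hp hne ⟨l', i'⟩ hp' hne' h
    have h0 := hpos l i (right_ne_zero_of_mul hne)
    have h0' := hpos l' i' (right_ne_zero_of_mul hne')
    simp only [Prod.mk.injEq] at h
    obtain ⟨h, rfl⟩ := h
    refine Prod.ext (funext fun j => ?_) rfl
    have hj := congrFun h j
    rcases eq_or_ne j i with rfl | hji
    · simp only [Pi.sub_apply, Pi.single_eq_same] at hj
      simp only at h0 h0' ⊢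
      omega
    · simpa [hji] using hj
  · rintro ⟨l, i⟩ hp hne
    obtain ⟨hsum, hanti⟩ := mem_betaSequences.1 (mem_product.1 hp).1
    have hsub : l + Pi.single i 1 - Pi.single i 1 = l := add_tsub_cancel_right _ _
    have hdown : (fun j => ((l + Pi.single i 1 : Fin k → ℕ) j : ℤ)) + Pi.single i (-1) =
        fun j => (l j : ℤ) := by
      rw [← hcast_sub _ i (by simp), hsub]
    refine ⟨(l + Pi.single i 1, i), mem_product.2 ⟨mem_betaSequences.2 ⟨?_, ?_⟩, mem_univ _⟩,
      ?_, ?_⟩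
    · simp only [Pi.add_apply, sum_add_distrib, hsingle] at hsum ⊢
      omega
    · refine Antitone.strictAnti_of_injective (fun a b hab => ?_) (hinj _ ?_)
      · rcases hab.eq_or_lt with rfl | hab
        · rfl
        · have : l b < l a := hanti hab
          have := hle_one i b
          simp only [Pi.add_apply] at this ⊢
          omega
      · rw [hcast_add]
        exact right_ne_zero_of_mul hne
    · rw [hdown, hcast_add, mul_comm]
      exact hne
    · rw [hsub]
  · rintro ⟨l, i⟩ hp hne
    have h0 := hpos l i (right_ne_zero_of_mul hne)
    have hup : l - Pi.single i 1 + Pi.single i 1 = l := by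
      ext j
      rcases eq_or_ne j i with rfl | h
      · simpa using Nat.sub_add_cancel h0
      · simp [h]
    simp only
    rw [← hcast_add, hup, hcast_sub l i h0, mul_comm]

theorem succ_mul_sum_sq_aitkenDet {k n : ℕ} (hn : n < k) :
    (n + 1 : ℝ) * ∑ l ∈ betaSequences k (n + 1), aitkenDet (fun j => (l j : ℤ)) ^ 2 =
      ∑ l ∈ betaSequences k n, aitkenDet (fun j => (l j : ℤ)) ^ 2 := by
  have h := sum_sum_aitkenDet_mul_comm k n
  simp_rw [← mul_sum] at h
  rw [mul_sum]
  refine Eq.trans (sum_congr rfl fun l hl => ?_) (h.trans (sum_congr rfl fun l hl => ?_))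
  · have hsum : (∑ i, (l i : ℝ)) = n + 1 + ∑ i : Fin k, (i : ℝ) := by
      exact_mod_cast (mem_betaSequences.1 hl).1
    rw [sum_aitkenDet_sub_single]
    simp only [Int.cast_natCast, hsum]
    ring
  · obtain ⟨r, hr⟩ := exists_eq_zero_of_mem_betaSequences hn hl
    rw [sum_aitkenDet_add_single _ (r := r) (by simp [hr]), sq]

namespace YoungDiagram

theorem colLen_le_card (μ : YoungDiagram) (j : ℕ) : μ.colLen j ≤ μ.card := by
  rw [colLen_eq_card]
  exact card_le_card (filter_subset _ _)

theorem rowLen_eq_zero_of_colLen_le {μ : YoungDiagram} {i : ℕ} (hi : μ.colLen 0 ≤ i) :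
    μ.rowLen i = 0 := by
  by_contra h
  have := mem_iff_lt_colLen.1 (mem_iff_lt_rowLen.2 (Nat.pos_of_ne_zero h))
  omega

theorem ext_rowLen {μ ν : YoungDiagram} (h : ∀ i, μ.rowLen i = ν.rowLen i) : μ = ν := by
  refine YoungDiagram.ext (Finset.ext fun c => ?_)
  rw [mem_cells, mem_cells, mem_iff_lt_rowLen (i := c.1), mem_iff_lt_rowLen (i := c.1), h]

theorem exists_rowLen_eq {r : ℕ → ℕ} (hr : Antitone r) {k : ℕ} (hk : r k = 0) :
    ∃ μ : YoungDiagram, ∀ i, μ.rowLen i = r i := by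
  have hmem (c : ℕ × ℕ) : c ∈ (range k ×ˢ range (r 0)).filter (fun c => c.2 < r c.1) ↔
      c.2 < r c.1 := by
    rw [mem_filter, mem_product, mem_range, mem_range]
    refine ⟨fun h => h.2, fun h => ⟨⟨?_, h.trans_le (hr (Nat.zero_le _))⟩, h⟩⟩
    by_contra! hc
    have := hr hc
    omega
  refine ⟨⟨(range k ×ˢ range (r 0)).filter fun c => c.2 < r c.1, fun a b hba ha => ?_⟩,
    fun i => eq_of_forall_lt_iff fun j => ?_⟩
  · rw [mem_coe, hmem] at ha ⊢
    exact (hba.2.trans_lt ha).trans_le (hr hba.1)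
  · rw [← mem_iff_lt_rowLen, ← hmem (i, j)]
    rfl

theorem prod_cells {M : Type*} [CommMonoid M] {μ : YoungDiagram} {k : ℕ} (hk : μ.colLen 0 ≤ k)
    (f : ℕ × ℕ → M) :
    ∏ c ∈ μ.cells, f c = ∏ i : Fin k, ∏ j ∈ range (μ.rowLen i), f (i, j) := by
  rw [Fin.prod_univ_eq_prod_range fun i => ∏ j ∈ range (μ.rowLen i), f (i, j)]
  refine prod_finset_product _ _ _ fun c => ?_
  rw [mem_cells, mem_range, mem_range, mem_iff_lt_rowLen (i := c.1)]
  refine ⟨fun h => ⟨?_, h⟩, fun h => h.2⟩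
  by_contra! hc
  rw [rowLen_eq_zero_of_colLen_le (hk.trans hc)] at h
  omega

theorem sum_rowLen {μ : YoungDiagram} {k : ℕ} (hk : μ.colLen 0 ≤ k) :
    ∑ i : Fin k, μ.rowLen i = μ.card := by
  have := prod_cells hk fun _ => Multiplicative.ofAdd 1
  simpa [← ofAdd_nsmul, ← ofAdd_sum] using congrArg Multiplicative.toAdd this.symm

/-- The first-column hook sequence of `μ` with `k` entries. -/
def betaSequence (k : ℕ) (μ : YoungDiagram) (i : Fin k) : ℕ := μ.rowLen i + i.rev

theorem strictAnti_betaSequence (k : ℕ) (μ : YoungDiagram) : StrictAnti (μ.betaSequence k) :=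
  fun i j hij => add_lt_add_of_le_of_lt (μ.rowLen_anti i j hij.le) (Fin.rev_lt_rev.2 hij)

theorem bijOn_betaSequence {k n : ℕ} (hn : n ≤ k) :
    Set.BijOn (betaSequence k) {μ | μ.card = n} (betaSequences k n) := by
  have hcol {μ : YoungDiagram} (hμ : μ.card = n) : μ.colLen 0 ≤ k :=
    (μ.colLen_le_card 0).trans (hμ.trans_le hn)
  refine ⟨fun μ (hμ : μ.card = n) => ?_, fun μ (hμ : μ.card = n) ν (hν : ν.card = n) h => ?_,
    fun l hl => ?_⟩
  · refine mem_betaSequences.2 ⟨?_, strictAnti_betaSequence k μ⟩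
    simp only [betaSequence]
    rw [sum_add_distrib, sum_val_rev, sum_rowLen (hcol hμ), hμ]
  · refine ext_rowLen fun i => ?_
    by_cases hi : i < k
    · exact Nat.add_right_cancel (congrFun h ⟨i, hi⟩)
    · rw [rowLen_eq_zero_of_colLen_le ((hcol hμ).trans (not_lt.1 hi)),
        rowLen_eq_zero_of_colLen_le ((hcol hν).trans (not_lt.1 hi))]
  · obtain ⟨hsum, hanti⟩ := mem_betaSequences.1 hl
    have hrev (i : Fin k) : (i.rev : ℕ) ≤ l i := hanti.rev_add_le (fun _ => Nat.zero_le _) i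
    obtain ⟨μ, hμ⟩ := exists_rowLen_eq (k := k)
      (r := fun i => if h : i < k then l ⟨i, h⟩ - (Fin.rev ⟨i, h⟩ : Fin k) else 0)
      (fun a b hab => by
        dsimp only
        split_ifs with hb ha
        · have := hanti.apply_add_val_le (Fin.mk_le_mk.2 hab : (⟨a, ha⟩ : Fin k) ≤ ⟨b, hb⟩)
          simp only [Fin.val_rev] at this ⊢
          omega
        · omega
        · omega
        · rfl) (by simp)
    have hβ : betaSequence k μ = l := by
      ext i
      have := hrev i
      simp only [betaSequence, hμ, i.isLt, dite_true, Fin.eta]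
      omega
    have hk : μ.colLen 0 ≤ k := by
      by_contra! h
      have := mem_iff_lt_rowLen.1 (mem_iff_lt_colLen.2 h)
      simp [hμ] at this
    refine ⟨μ, ?_, hβ⟩
    have : ∑ i, betaSequence k μ i = μ.card + ∑ i : Fin k, (i : ℕ) := by
      simp only [betaSequence]
      rw [sum_add_distrib, sum_val_rev, sum_rowLen hk]
    rw [hβ, hsum] at this
    exact (Nat.add_right_cancel this).symm


theorem prod_hook_row_mul_prod {k : ℕ} {μ : YoungDiagram} (hk : μ.colLen 0 ≤ k) (i : Fin k) :
    (∏ j ∈ range (μ.rowLen i), hook μ (i, j)) *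
        ∏ m ∈ Ioi i, (betaSequence k μ i - betaSequence k μ m) =
      (betaSequence k μ i).factorial := by
  have hanti := strictAnti_betaSequence k μ
  have hcol {j : ℕ} (hj : j < μ.rowLen i) : (i : ℕ) < μ.colLen j ∧ μ.colLen j ≤ k :=
    ⟨mem_iff_lt_colLen.1 (mem_iff_lt_rowLen.2 hj), (μ.colLen_anti 0 j (Nat.zero_le j)).trans hk⟩
  have hhook : Set.InjOn (fun j => hook μ (i, j)) (range (μ.rowLen i)) := by
    refine StrictAntiOn.injOn fun a ha b hb hab => ?_
    have := hcol (mem_range.1 ha)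
    have := hcol (mem_range.1 hb)
    have := μ.colLen_anti a b hab.le
    have := mem_range.1 hb
    simp only [hook]
    omega
  have hdiff : Set.InjOn (fun m => betaSequence k μ i - betaSequence k μ m) (Ioi i) := by
    refine StrictMonoOn.injOn fun a ha b hb hab => ?_
    have := hanti (mem_Ioi.1 ha)
    have := hanti (mem_Ioi.1 hb)
    have := hanti hab
    omega
  have hdisj : Disjoint ((range (μ.rowLen i)).image fun j => hook μ (i, j))
      ((Ioi i).image fun m => betaSequence k μ i - betaSequence k μ m) := by
    rw [disjoint_left]
    simp only [mem_image, mem_range, mem_Ioi, not_exists, not_and, forall_exists_index, and_imp]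
    rintro _ j hj rfl m hm h
    have hiff : j < μ.rowLen m ↔ (m : ℕ) < μ.colLen j := by
      rw [← mem_iff_lt_rowLen, mem_iff_lt_colLen]
    have := hcol hj
    have hm' : (i : ℕ) < m := hm
    have := μ.rowLen_anti i m hm'.le
    simp only [hook, betaSequence, Fin.val_rev] at h
    omega
  have hunion : ((range (μ.rowLen i)).image fun j => hook μ (i, j)) ∪
      ((Ioi i).image fun m => betaSequence k μ i - betaSequence k μ m) =
      Icc 1 (betaSequence k μ i) := by
    refine eq_of_subset_of_card_le (union_subset ?_ ?_) ?_
    · refine image_subset_iff.2 fun j hj => mem_Icc.2 ?_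
      have := hcol (mem_range.1 hj)
      have := mem_range.1 hj
      simp only [hook, betaSequence, Fin.val_rev]
      omega
    · refine image_subset_iff.2 fun m hm => mem_Icc.2 ?_
      have := hanti (mem_Ioi.1 hm)
      omega
    · rw [card_union_of_disjoint hdisj, card_image_of_injOn hhook, card_image_of_injOn hdiff]
      simp only [Nat.card_Icc, card_range, Fin.card_Ioi, betaSequence, Fin.val_rev]
      omega
  rw [← prod_Ico_id_eq_factorial, Ico_add_one_right_eq_Icc, ← hunion, prod_union hdisj,
    prod_image hhook, prod_image hdiff]

theorem sq_aitkenDet_betaSequence {k : ℕ} {μ : YoungDiagram} (hk : μ.colLen 0 ≤ k) :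
    aitkenDet (fun i => (betaSequence k μ i : ℤ)) ^ 2 =
      ((∏ c ∈ μ.cells, (hook μ c : ℝ)) ^ 2)⁻¹ := by
  rw [aitkenDet_natCast, prod_cells hk, ← prod_mul_distrib, ← prod_pow, ← prod_pow,
    ← prod_inv_distrib]
  refine prod_congr rfl fun i _ => ?_
  have hfact := congrArg (Nat.cast : ℕ → ℝ) (prod_hook_row_mul_prod hk i)
  have hne : ((betaSequence k μ i).factorial : ℝ) ≠ 0 := by positivity
  have hdiff : (∏ m ∈ Ioi i, ((betaSequence k μ m : ℝ) - betaSequence k μ i)) ^ 2 =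
      ((∏ m ∈ Ioi i, (betaSequence k μ i - betaSequence k μ m) : ℕ) : ℝ) ^ 2 := by
    rw [Nat.cast_prod, ← prod_pow, ← prod_pow]
    refine prod_congr rfl fun m hm => ?_
    rw [Nat.cast_sub (strictAnti_betaSequence k μ (mem_Ioi.1 hm)).le, sub_sq_comm]
  rw [Nat.cast_mul, Nat.cast_prod] at hfact
  rw [← hfact] at hne ⊢
  have := left_ne_zero_of_mul hne
  have := right_ne_zero_of_mul hne
  rw [mul_pow, hdiff]
  field_simp

theorem finite_setOf_card_eq (n : ℕ) : {μ : YoungDiagram | μ.card = n}.Finite :=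
  (bijOn_betaSequence le_rfl).finite_iff_finite.2 (finite_toSet _)

/-- The Young diagrams with `n` boxes. -/
noncomputable def ofCard (n : ℕ) : Finset YoungDiagram := (finite_setOf_card_eq n).toFinset

theorem mem_ofCard {n : ℕ} {μ : YoungDiagram} : μ ∈ ofCard n ↔ μ.card = n := by
  simp [ofCard]

theorem sum_ofCard_eq_sum_betaSequences {k n : ℕ} (hn : n ≤ k) :
    ∑ μ ∈ ofCard n, ((∏ c ∈ μ.cells, (hook μ c : ℝ)) ^ 2)⁻¹ =
      ∑ l ∈ betaSequences k n, aitkenDet (fun i => (l i : ℤ)) ^ 2 := by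
  obtain ⟨hmaps, hinj, hsurj⟩ := bijOn_betaSequence hn
  refine sum_bij (fun μ _ => betaSequence k μ) (fun μ hμ => hmaps (mem_ofCard.1 hμ))
    (fun μ hμ ν hν h => hinj (mem_ofCard.1 hμ) (mem_ofCard.1 hν) h) (fun l hl => ?_)
    fun μ hμ => ?_
  · obtain ⟨μ, hμ, h⟩ := hsurj hl
    exact ⟨μ, mem_ofCard.2 hμ, h⟩
  · rw [sq_aitkenDet_betaSequence ((μ.colLen_le_card 0).trans ((mem_ofCard.1 hμ).trans_le hn))]

theorem sum_ofCard_inv_sq_prod_hook (n : ℕ) :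
    ∑ μ ∈ ofCard n, ((∏ c ∈ μ.cells, (hook μ c : ℝ)) ^ 2)⁻¹ = (n.factorial : ℝ)⁻¹ := by
  induction n with
  | zero =>
    have : ofCard 0 = {⊥} := by
      ext μ
      rw [mem_ofCard, mem_singleton, YoungDiagram.card, card_eq_zero, YoungDiagram.ext_iff,
        cells_bot]
    simp [this]
  | succ n ih =>
    rw [sum_ofCard_eq_sum_betaSequences (Nat.le_succ n),
      ← succ_mul_sum_sq_aitkenDet (Nat.lt_succ_self n),
      ← sum_ofCard_eq_sum_betaSequences le_rfl] at ih
    rw [Nat.factorial_succ, Nat.cast_mul, mul_inv, ← ih]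
    push_cast
    field_simp

theorem hasSum_pow_card_mul_inv_sq_prod_hook (q : ℝ) :
    HasSum (fun μ : YoungDiagram =>
      q ^ μ.card * ((∏ c ∈ μ.cells, (hook μ c : ℝ)) ^ 2)⁻¹) (Real.exp q) := by
  let e := Equiv.sigmaFiberEquiv YoungDiagram.card
  have hfiber (x : ℝ) (n : ℕ) : HasSum (fun μ : {μ : YoungDiagram // μ.card = n} =>
      x ^ μ.1.card * ((∏ c ∈ μ.1.cells, (hook μ.1 c : ℝ)) ^ 2)⁻¹) (x ^ n / n.factorial) := by
    have hfin : Fintype {μ : YoungDiagram // μ.card = n} := (finite_setOf_card_eq n).fintype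
    have hsum : ∑ μ ∈ ofCard n, x ^ μ.card * ((∏ c ∈ μ.cells, (hook μ c : ℝ)) ^ 2)⁻¹ =
        x ^ n / n.factorial := by
      rw [div_eq_mul_inv, ← sum_ofCard_inv_sq_prod_hook, mul_sum]
      exact sum_congr rfl fun μ hμ => by rw [mem_ofCard.1 hμ]
    rw [← hsum, sum_subtype (ofCard n) (fun μ => mem_ofCard)]
    exact hasSum_fintype _
  have hexp (x : ℝ) : HasSum (fun n : ℕ => x ^ n / n.factorial) (Real.exp x) := by
    rw [Real.exp_eq_exp_ℝ]
    exact NormedSpace.expSeries_div_hasSum_exp x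
  rw [← e.hasSum_iff]
  refine HasSum.sigma_of_hasSum (hexp q) (hfiber q) ?_
  refine Summable.of_norm ((summable_sigma_of_nonneg fun _ => norm_nonneg _).2 ?_)
  have hnorm (n : ℕ) : HasSum (fun μ : {μ : YoungDiagram // μ.card = n} =>
      ‖q ^ μ.1.card * ((∏ c ∈ μ.1.cells, (hook μ.1 c : ℝ)) ^ 2)⁻¹‖)
      (|q| ^ n / n.factorial) := by
    simpa [abs_mul, abs_inv, abs_pow] using hfiber |q| n
  exact ⟨fun n => (hnorm n).summable, (hexp |q|).summable.congr fun n => (hnorm n).tsum_eq.symm⟩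

end YoungDiagram

/-- Σ_λ q^{|λ|} ∏_{□∈λ} h_□^{-2} = e^q, summing over all partitions. -/
theorem stmt5 (q : ℝ) :
    ∑' μ : YoungDiagram, q ^ μ.cells.card * ((∏ c ∈ μ.cells, (hook μ c : ℝ))^2)⁻¹
      = Real.exp q :=
  (YoungDiagram.hasSum_pow_card_mul_inv_sq_prod_hook q).tsum_eq
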